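/- Let p be an odd prime and K a finite field extension of ℚ_p. For a quadratic form Q of degree m over K, let D(Q) denote the number of m-tuples in (Kˣ/(Kˣ)²)^m — that is, m-tuples (a₁,…,a_m) of elements of Kˣ counted up to multiplying each entry by a nonzero square — such that the diagonal form ⟨a₁,…,a_m⟩ is isometric to Q. Then: D(Q) = 4 when Q is the hyperbolic plane H; and when Q is anisotropic of degree m, D(Q) = 1 if m = 1, D(Q) = 2 if m = 2, D(Q) = 6 if m = 3, and D(Q) = 24 if m = 4. In particular, for anisotropic Q the number D(Q) depends only on the degree m of Q. -/

import Mathlib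

/-- A quadratic form of degree `m` over `K`: a quadratic form on `Fin m → K`. -/
abbrev QF (K : Type) [Field K] (m : ℕ) : Type := QuadraticForm K (Fin m → K)

/-- Two quadratic forms are isometric if there is a linear equivalence of the underlying
spaces carrying one to the other. -/
def QIsom {K : Type} [Field K] {M M' : Type} [AddCommGroup M] [Module K M]
    [AddCommGroup M'] [Module K M'] (Q : QuadraticForm K M) (Q' : QuadraticForm K M') : Prop :=
  ∃ φ : M ≃ₗ[K] M', ∀ x, Q' (φ x) = Q x

/-- The hyperbolic plane `(x, y) ↦ x * y` on `K²`. -/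
noncomputable def HypForm (K : Type) [Field K] : QuadraticForm K (K × K) :=
  QuadraticMap.linMulLin (LinearMap.fst K K K) (LinearMap.snd K K K)

/-- Orthogonal sum of `m` copies of the hyperbolic plane. -/
noncomputable def HypSum (K : Type) [Field K] (m : ℕ) : QuadraticForm K (Fin m → K × K) :=
  QuadraticMap.pi (fun _ : Fin m => HypForm K)

/-- Witt equivalence of quadratic forms. -/
def WittEquiv {K : Type} [Field K] {M M' : Type} [AddCommGroup M] [Module K M]
    [AddCommGroup M'] [Module K M'] (Q : QuadraticForm K M) (Q' : QuadraticForm K M') : Prop :=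
  ∃ a b : ℕ, QIsom (Q.prod (HypSum K a)) (Q'.prod (HypSum K b))

/-- A quadratic form is nondegenerate if its polar bilinear form is nondegenerate. -/
def QNondeg {K : Type} [Field K] {M : Type} [AddCommGroup M] [Module K M]
    (Q : QuadraticForm K M) : Prop :=
  ∀ v, (∀ w, QuadraticMap.polar (⇑Q) v w = 0) → v = 0

/-- The diagonal quadratic form `⟨a₁, …, a_m⟩`. -/
noncomputable def diagQF {K : Type} [Field K] {m : ℕ} (r : Fin m → Kˣ) : QF K m :=
  QuadraticMap.weightedSumSquares K (fun i => (r i : K))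

/-- The Lie algebra `so(Q)`. -/
def soSet {K : Type} [Field K] {M : Type} [AddCommGroup M] [Module K M]
    (Q : QuadraticForm K M) : Set (Module.End K M) :=
  {X | ∀ v w, QuadraticMap.polar (⇑Q) (X v) w + QuadraticMap.polar (⇑Q) v (X w) = 0}

/-- Membership in the orthogonal group `O(Q)` (as invertible linear maps preserving `Q`). -/
def InO {K : Type} [Field K] {M : Type} [AddCommGroup M] [Module K M]
    (Q : QuadraticForm K M) (g : M ≃ₗ[K] M) : Prop :=
  ∀ v, Q (g v) = Q v

/-- Membership in the special orthogonal group `SO(Q)`. -/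
def InSO {K : Type} [Field K] {M : Type} [AddCommGroup M] [Module K M]
    (Q : QuadraticForm K M) (g : M ≃ₗ[K] M) : Prop :=
  InO Q g ∧ LinearMap.det (g : M →ₗ[K] M) = 1

/-- A nilpotent endomorphism has Jordan type `λ` when `dim ker (X^i) = Σ_j min(i, λ_j)`. -/
def HasJordanType {K : Type} [Field K] {M : Type} [AddCommGroup M] [Module K M]
    {n : ℕ} (X : Module.End K M) (lam : Nat.Partition n) : Prop :=
  ∀ i : ℕ, Module.finrank K (LinearMap.ker (X ^ i)) = (lam.parts.map (fun part => min i part)).sum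

/-- `Λ(n)`: partitions of `n` in which every even part has even multiplicity. -/
def LambdaSet (n : ℕ) : Set (Nat.Partition n) :=
  {lam | ∀ j : ℕ, Even j → Even (lam.parts.count j)}


/-- `DCount K m Q`: the number of `m`-tuples in `(Kˣ/(Kˣ)²)^m` whose diagonal form is
isometric to `Q`. -/
noncomputable def DCount (K : Type) [Field K] (m : ℕ) {M : Type} [AddCommGroup M] [Module K M]
    (Q : QuadraticForm K M) : ℕ :=
  Nat.card (Quot (fun (r r' : {r : Fin m → Kˣ // QIsom (diagQF r) Q}) =>
    ∀ i, ∃ u : Kˣ, r'.1 i = r.1 i * u ^ 2))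

/-- The square class data of a non-dyadic local field. -/
structure SqData (K : Type) [Field K] where
  c : Kˣ → ZMod 2 × ZMod 2
  c_mul : ∀ a b, c (a * b) = c a + c b
  c_zero : ∀ a, c a = 0 ↔ ∃ s : Kˣ, a = s ^ 2
  c_surj : Function.Surjective c
  u : Kˣ
  c_u : c u = (1, 0)
  c_neg : (c (-1)).2 = 0
  aniso : ∀ (a b : Kˣ) (x y z w : K), (c a).2 ≠ (c b).2 →
    a * (x ^ 2 - u * y ^ 2) + b * (z ^ 2 - u * w ^ 2) = 0 → (x = 0 ∧ y = 0) ∧ z = 0 ∧ w = 0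
  sumsq : ∃ s t : K, s ^ 2 + t ^ 2 = -1
  two : (2 : K) ≠ 0

section isom
variable {K : Type} [Field K] {M M' M'' : Type} [AddCommGroup M] [Module K M]
  [AddCommGroup M'] [Module K M'] [AddCommGroup M''] [Module K M'']

theorem QIsom.symm' {Q : QuadraticForm K M} {Q' : QuadraticForm K M'} (h : QIsom Q Q') :
    QIsom Q' Q := by
  obtain ⟨φ, hφ⟩ := h
  exact ⟨φ.symm, fun x => by rw [← hφ]; simp⟩

theorem QIsom.trans' {Q : QuadraticForm K M} {Q' : QuadraticForm K M'} {Q'' : QuadraticForm K M''}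
    (h : QIsom Q Q') (h' : QIsom Q' Q'') : QIsom Q Q'' := by
  obtain ⟨φ, hφ⟩ := h
  obtain ⟨ψ, hψ⟩ := h'
  exact ⟨φ.trans ψ, fun x => by simp [hφ, hψ]⟩

theorem QIsom.aniso {Q : QuadraticForm K M} {Q' : QuadraticForm K M'} (h : QIsom Q Q')
    (hQ : QuadraticMap.Anisotropic Q') : QuadraticMap.Anisotropic Q := by
  obtain ⟨φ, hφ⟩ := h
  intro x hx
  rw [← hφ] at hx
  simpa using hQ _ hx

theorem qisom_of_map [FiniteDimensional K M] [FiniteDimensional K M']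
    (hd : Module.finrank K M = Module.finrank K M')
    {Q : QuadraticForm K M} {Q' : QuadraticForm K M'} (φ : M →ₗ[K] M')
    (hφ : ∀ x, Q' (φ x) = Q x) (hinj : Function.Injective φ) : QIsom Q Q' :=
  ⟨LinearEquiv.ofInjectiveOfFinrankEq φ hinj hd, fun x => hφ x⟩

theorem qisom_of_map_aniso [FiniteDimensional K M] [FiniteDimensional K M']
    (hd : Module.finrank K M = Module.finrank K M')
    {Q : QuadraticForm K M} {Q' : QuadraticForm K M'} (hQ : QuadraticMap.Anisotropic Q)
    (φ : M →ₗ[K] M') (hφ : ∀ x, Q' (φ x) = Q x) : QIsom Q Q' := by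
  refine qisom_of_map hd φ hφ ?_
  rw [injective_iff_map_eq_zero]
  intro x hx
  apply hQ
  rw [← hφ, hx, QuadraticMap.map_zero]

theorem diagQF_apply {m : ℕ} (r : Fin m → Kˣ) (v : Fin m → K) :
    diagQF r v = ∑ i, (r i : K) * (v i * v i) := by
  simp [diagQF, QuadraticMap.weightedSumSquares_apply]

theorem diagQF_cons {m : ℕ} (a : Kˣ) (r : Fin m → Kˣ) (x : K) (v : Fin m → K) :
    diagQF (Fin.cons a r : Fin (m + 1) → Kˣ) (Fin.cons x v : Fin (m + 1) → K) =
      a * (x * x) + diagQF r v := by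
  simp [diagQF_apply, Fin.sum_univ_succ]

theorem diagQF_three {m : ℕ} (r : Fin m → Kˣ) {i j k : Fin m} (hij : i ≠ j) (hjk : j ≠ k)
    (hik : i ≠ k) (x y z : K) :
    diagQF r (fun l => if l = i then x else if l = j then y else if l = k then z else 0) =
      r i * (x * x) + r j * (y * y) + r k * (z * z) := by
  have h : ∀ l, (r l : K) * ((if l = i then x else if l = j then y else if l = k then z else 0) *
      (if l = i then x else if l = j then y else if l = k then z else 0)) =
      ((if l = i then r i * (x * x) else 0) + (if l = j then r j * (y * y) else 0)) +
      (if l = k then r k * (z * z) else 0) := by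
    intro l
    by_cases h1 : l = i
    · subst h1; simp [hij, hik]
    by_cases h2 : l = j
    · subst h2; simp [h1, hjk]
    by_cases h3 : l = k
    · subst h3; simp [h1, h2]
    simp [h1, h2, h3]
  rw [diagQF_apply, Finset.sum_congr rfl (fun l _ => h l)]
  simp [Finset.sum_add_distrib]

theorem diagQF_two {m : ℕ} (r : Fin m → Kˣ) {i j : Fin m} (hij : i ≠ j) (x y : K) :
    diagQF r (fun l => if l = i then x else if l = j then y else 0) =
      r i * (x * x) + r j * (y * y) := by
  have h : ∀ l, (r l : K) * ((if l = i then x else if l = j then y else 0) *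
      (if l = i then x else if l = j then y else 0)) =
      ((if l = i then r i * (x * x) else 0) + (if l = j then r j * (y * y) else 0)) := by
    intro l
    by_cases h1 : l = i
    · subst h1; simp [hij]
    by_cases h2 : l = j
    · subst h2; simp [h1]
    simp [h1, h2]
  rw [diagQF_apply, Finset.sum_congr rfl (fun l _ => h l)]
  simp [Finset.sum_add_distrib]

/-- Diagonalization of anisotropic forms. -/
theorem exists_diag (h2 : (2 : K) ≠ 0) [FiniteDimensional K M] {m : ℕ}
    (hm : Module.finrank K M = m) (Q : QuadraticForm K M) (hQ : QuadraticMap.Anisotropic Q) :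
    ∃ r : Fin m → Kˣ, QIsom (diagQF r) Q := by
  subst hm
  have : Invertible (2 : K) := invertibleOfNonzero h2
  obtain ⟨w, ⟨e⟩⟩ := Q.equivalent_weightedSumSquares_units_of_nondegenerate'
    (QuadraticMap.separatingLeft_of_anisotropic Q hQ)
  refine ⟨w, QIsom.symm' ⟨e.toLinearEquiv, fun x => ?_⟩⟩
  rw [← e.map_app x, diagQF_apply, QuadraticMap.weightedSumSquares_apply]
  rfl

/-- Splitting off a represented value. -/
theorem exists_cons (h2 : (2 : K) ≠ 0) {m : ℕ} (Q : QF K (m + 1))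
    (hQ : QuadraticMap.Anisotropic Q) (a : Kˣ) (v : Fin (m + 1) → K) (hv : Q v = a) :
    ∃ r : Fin m → Kˣ, QIsom (diagQF (Fin.cons a r : Fin (m + 1) → Kˣ)) Q := by
  let f : (Fin (m + 1) → K) →ₗ[K] K := QuadraticMap.polarBilin Q v
  have hf : ∀ x, f x = QuadraticMap.polar Q v x := fun x => rfl
  have hfv : f v ≠ 0 := by
    rw [hf, QuadraticMap.polar_self, hv]
    simpa using h2
  have hsurj : LinearMap.range f = ⊤ := by
    rw [LinearMap.range_eq_top]
    intro y
    exact ⟨(y / f v) • v, by simp [hfv]⟩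
  have hrank : Module.finrank K (LinearMap.ker f) = m := by
    have := LinearMap.finrank_range_add_finrank_ker f
    rw [hsurj, finrank_top, Module.finrank_self, Module.finrank_fin_fun] at this
    omega
  let Q' : QuadraticForm K (LinearMap.ker f) := Q.comp (LinearMap.ker f).subtype
  have hQ' : QuadraticMap.Anisotropic Q' := by
    intro x hx
    have := hQ (x : Fin (m + 1) → K) hx
    exact Subtype.ext this
  obtain ⟨r, e, he⟩ := exists_diag h2 hrank Q' hQ'
  refine ⟨r, ?_⟩
  let φ : (Fin (m + 1) → K) →ₗ[K] (Fin (m + 1) → K) :=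
    (LinearMap.toSpanSingleton K _ v).comp (LinearMap.proj 0) +
      (LinearMap.ker f).subtype.comp (e.toLinearMap.comp (LinearMap.funLeft K K Fin.succ))
  have hφ : ∀ (x : K) (w : Fin m → K), φ (Fin.cons x w : Fin (m + 1) → K) =
      x • v + (e w : Fin (m + 1) → K) := by
    intro x w
    have : LinearMap.funLeft K K Fin.succ (Fin.cons x w : Fin (m + 1) → K) = w := by
      ext i; simp [LinearMap.funLeft_apply]
    simp [φ, this]
  have hQφ : ∀ (x : K) (w : Fin m → K), Q (x • v + (e w : Fin (m + 1) → K)) =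
      a * (x * x) + diagQF r w := by
    intro x w
    have h1 : QuadraticMap.polar Q v (e w : Fin (m + 1) → K) = 0 := by
      rw [← hf]; exact (e w).2
    have h3 : Q (e w : Fin (m + 1) → K) = diagQF r w := he w
    rw [QuadraticMap.map_add (⇑Q), QuadraticMap.polar_smul_left, h1, h3, QuadraticMap.map_smul, hv]
    simp; ring
  refine qisom_of_map rfl φ ?_ ?_
  · intro x
    rw [← Fin.cons_self_tail x, hφ, hQφ, diagQF_cons]
  · rw [injective_iff_map_eq_zero]
    intro x hx
    rw [← Fin.cons_self_tail x] at hx ⊢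
    rw [hφ] at hx
    have h0 : f (x 0 • v + (e (Fin.tail x) : Fin (m + 1) → K)) = 0 := by rw [hx, map_zero]
    have h4 : f (e (Fin.tail x) : Fin (m + 1) → K) = 0 := (e _).2
    rw [map_add, h4, add_zero, map_smul, smul_eq_mul, mul_eq_zero] at h0
    have hx0 := h0.resolve_right hfv
    rw [hx0, zero_smul, zero_add] at hx
    have : e (Fin.tail x) = 0 := Subtype.ext hx
    have : Fin.tail x = 0 := by simpa using this
    rw [this, hx0]
    ext i
    refine Fin.cases ?_ (fun j => ?_) i <;> simp

/-- Witt cancellation for anisotropic diagonal forms. -/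
theorem witt_cancel (h2 : (2 : K) ≠ 0) {m : ℕ} (a : Kˣ) (r s : Fin m → Kˣ)
    (ha : QuadraticMap.Anisotropic (diagQF (Fin.cons a s : Fin (m + 1) → Kˣ)))
    (h : QIsom (diagQF (Fin.cons a r : Fin (m + 1) → Kˣ))
      (diagQF (Fin.cons a s : Fin (m + 1) → Kˣ))) : QIsom (diagQF r) (diagQF s) := by
  have ha' := h.aniso ha
  obtain ⟨φ, hφ⟩ := h
  set Q := diagQF (Fin.cons a s : Fin (m + 1) → Kˣ) with hQ
  let e : Fin (m + 1) → K := Fin.cons 1 0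
  have hQe : Q e = a := by simp only [hQ, e]; rw [diagQF_cons]; simp
  have hw : Q (φ e) = a := by rw [hφ]; simp only [e]; rw [diagQF_cons]; simp
  have hpol : ∀ y : Fin (m + 1) → K, QuadraticMap.polar Q e y = 2 * a * y 0 := by
    intro y
    obtain ⟨y0, y, rfl⟩ : ∃ (y0 : K) (y' : Fin m → K), y = (Fin.cons y0 y' : Fin (m + 1) → K) :=
      ⟨y 0, Fin.tail y, (Fin.cons_self_tail y).symm⟩
    have hadd : e + (Fin.cons y0 y : Fin (m + 1) → K) =
        (Fin.cons (1 + y0) y : Fin (m + 1) → K) := by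
      ext i
      refine Fin.cases ?_ (fun j => ?_) i <;> simp [e]
    rw [QuadraticMap.polar, hadd, hQe, hQ, diagQF_cons, diagQF_cons]
    simp; ring
  -- the reflection
  obtain ⟨τ, hτ, hτe⟩ : ∃ τ : (Fin (m + 1) → K) →ₗ[K] (Fin (m + 1) → K),
      (∀ x, Q (τ x) = Q x) ∧ τ (φ e) = e := by
    by_cases hd : φ e - e = 0
    · exact ⟨LinearMap.id, fun _ => rfl, by simpa using sub_eq_zero.1 hd⟩
    · set d := φ e - e with hdd
      have hQd : Q d ≠ 0 := fun h => hd (ha _ h)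
      let g : (Fin (m + 1) → K) →ₗ[K] K := QuadraticMap.polarBilin Q d
      have hg : ∀ x, g x = QuadraticMap.polar Q d x := fun _ => rfl
      refine ⟨LinearMap.id - (Q d)⁻¹ • (LinearMap.toSpanSingleton K _ d).comp g, ?_, ?_⟩
      · intro x
        have : (LinearMap.id - (Q d)⁻¹ • (LinearMap.toSpanSingleton K _ d).comp g :
          (Fin (m + 1) → K) →ₗ[K] (Fin (m + 1) → K)) x = x + (-((Q d)⁻¹ * g x)) • d := by
          simp [smul_smul, sub_eq_add_neg]
        rw [this, QuadraticMap.map_add (⇑Q), QuadraticMap.polar_smul_right, QuadraticMap.map_smul, hg,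
          QuadraticMap.polar_comm Q x d]
        simp only [smul_eq_mul]
        field_simp
        ring
      · have hgw : g (φ e) = Q d := by
          have h1 : Q d = Q (φ e) + Q e - QuadraticMap.polar Q (φ e) e := by
            rw [hdd, sub_eq_add_neg, QuadraticMap.map_add (⇑Q), QuadraticMap.polar_neg_right,
              QuadraticMap.map_neg]
            ring
          rw [hg, h1, hdd, QuadraticMap.polar_sub_left, QuadraticMap.polar_self, hw, hQe,
            QuadraticMap.polar_comm Q e]
          simp; ring
        simp only [LinearMap.sub_apply, LinearMap.id_apply, LinearMap.smul_apply,
          LinearMap.comp_apply, LinearMap.toSpanSingleton_apply, hgw]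
        rw [smul_smul, inv_mul_cancel₀ hQd, one_smul, hdd]
        abel
  let ι : (Fin m → K) →ₗ[K] (Fin (m + 1) → K) :=
    { toFun := fun x => Fin.cons 0 x
      map_add' := fun x y => by
        ext i
        refine Fin.cases ?_ (fun j => ?_) i <;> simp
      map_smul' := fun c x => by
        ext i
        refine Fin.cases ?_ (fun j => ?_) i <;> simp }
  have hι : ∀ x, ι x = (Fin.cons 0 x : Fin (m + 1) → K) := fun _ => rfl
  have hr : QuadraticMap.Anisotropic (diagQF r) := by
    intro x hx
    have h1 := ha' (Fin.cons 0 x) (by rw [diagQF_cons, hx]; simp)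
    ext i
    simpa using congrFun h1 i.succ
  refine qisom_of_map_aniso rfl hr
    ((LinearMap.funLeft K K Fin.succ).comp (τ.comp (φ.toLinearMap.comp ι))) ?_
  intro x
  have hz : (τ (φ (ι x))) 0 = 0 := by
    have h1 : QuadraticMap.polar Q e (τ (φ (ι x))) = 0 := by
      rw [← hτe, QuadraticMap.polar, ← map_add, hτ, hτ, hτ, ← map_add, hφ, hφ, hφ]
      have : e + ι x = (Fin.cons 1 x : Fin (m + 1) → K) := by
        rw [hι]
        ext i
        refine Fin.cases ?_ (fun j => ?_) i <;> simp [e]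
      rw [this, hι]
      simp only [e]
      rw [diagQF_cons, diagQF_cons, diagQF_cons]
      simp
    rw [hpol] at h1
    simpa [h2] using h1
  have h3 : Q (τ (φ (ι x))) = diagQF r x := by
    rw [hτ, hφ, hι, diagQF_cons]; simp
  rw [← h3]
  generalize hy : τ (φ (ι x)) = y at hz
  simp only [LinearMap.comp_apply, LinearEquiv.coe_coe, hy]
  conv_rhs => rw [← Fin.cons_self_tail y]
  rw [hQ, diagQF_cons, hz]
  simp only [mul_zero, zero_add]
  rfl
end isom

section classes
variable {K : Type} [Field K] (D : SqData K)

theorem SqData.c_sq (s : Kˣ) : D.c (s ^ 2) = 0 := (D.c_zero _).2 ⟨s, rfl⟩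

theorem SqData.c_eq_iff (a b : Kˣ) : D.c a = D.c b ↔ ∃ s : Kˣ, b = a * s ^ 2 := by
  constructor
  · intro h
    have h1 : D.c (a * (a⁻¹ * b)) = D.c a + D.c (a⁻¹ * b) := D.c_mul _ _
    rw [mul_inv_cancel_left, ← h] at h1
    have h2 : D.c (a⁻¹ * b) = 0 := by simpa using h1
    obtain ⟨s, hs⟩ := (D.c_zero _).1 h2
    exact ⟨s, by rw [← hs, mul_inv_cancel_left]⟩
  · rintro ⟨s, rfl⟩
    rw [D.c_mul, D.c_sq, add_zero]

theorem SqData.c_neg' (a : Kˣ) : D.c (-a) = D.c (-1) + D.c a := by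
  rw [← D.c_mul, neg_one_mul]

theorem SqData.c_neg_snd (a : Kˣ) : (D.c (-a)).2 = (D.c a).2 := by
  rw [D.c_neg', Prod.snd_add, D.c_neg, zero_add]

theorem SqData.diag_congr {m : ℕ} (r r' : Fin m → Kˣ) (h : ∀ i, D.c (r i) = D.c (r' i)) :
    QIsom (diagQF r) (diagQF r') := by
  have h' : ∀ i, ∃ s : Kˣ, r i = r' i * s ^ 2 := fun i => (D.c_eq_iff _ _).1 (h i).symm
  choose s hs using h'
  refine ⟨LinearEquiv.piCongrRight (fun i => LinearEquiv.smulOfUnit (s i)), fun x => ?_⟩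
  rw [diagQF_apply, diagQF_apply]
  refine Finset.sum_congr rfl fun i _ => ?_
  have : (LinearEquiv.piCongrRight (fun i => LinearEquiv.smulOfUnit (M := K) (s i)) :
    (Fin m → K) ≃ₗ[K] (Fin m → K)) x i = (s i : K) * x i := rfl
  rw [this, hs i]
  push_cast
  ring

/-- The combinatorial criterion for anisotropy. -/
def SqData.Good {m : ℕ} (r : Fin m → Kˣ) : Prop :=
  (∀ i j, i ≠ j → D.c (r j) ≠ D.c (-(r i))) ∧
  (∀ i j k, i ≠ j → j ≠ k → i ≠ k → (D.c (r i)).2 = (D.c (r j)).2 →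
    (D.c (r i)).2 = (D.c (r k)).2 → False)

theorem zmod_aux2 : ∀ n a b : ZMod 2 × ZMod 2, n.2 = 0 → b ≠ n + a →
    a.2 = b.2 → b = n + ((1, 0) + a) := by decide

theorem zmod_aux {n a b c : ZMod 2 × ZMod 2} (hn : n.2 = 0) (h1 : b ≠ n + a) (h2 : c ≠ n + a)
    (h3 : c ≠ n + b) (e1 : a.2 = b.2) (e2 : a.2 = c.2) : a = b ∧ a = c := by
  have b1 := zmod_aux2 n a b hn h1 e1
  have b2 := zmod_aux2 n a c hn h2 e2
  have b3 := zmod_aux2 n b c hn h3 (e1.symm.trans e2)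
  rw [b2, add_right_inj, add_right_inj] at b3
  exact ⟨b3, b3.trans (b1.trans b2.symm)⟩

theorem SqData.good_of_aniso {m : ℕ} (r : Fin m → Kˣ)
    (h : QuadraticMap.Anisotropic (diagQF r)) : D.Good r := by
  have h1 : ∀ i j, i ≠ j → D.c (r j) ≠ D.c (-(r i)) := by
    intro i j hij hc
    obtain ⟨s, hs⟩ := (D.c_eq_iff _ _).1 hc
    have h0 := h _ (show diagQF r (fun l => if l = i then (1 : K) else if l = j then s else 0) = 0 by
      rw [diagQF_two r hij]
      have : (r i : K) = -(r j * s ^ 2) := by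
        have := congrArg (fun x : Kˣ => -(x : K)) hs
        simpa using this
      rw [this]; ring)
    have := congrFun h0 i
    simp at this
  refine ⟨h1, fun i j k hij hjk hik e1 e2 => ?_⟩
  have a1 := h1 i j hij
  have a2 := h1 i k hik
  have a3 := h1 j k hjk
  rw [D.c_neg'] at a1 a2 a3
  obtain ⟨b1, b2⟩ := zmod_aux D.c_neg a1 a2 a3 e1 e2
  obtain ⟨s, hs⟩ := (D.c_eq_iff _ _).1 b1.symm
  obtain ⟨t, ht⟩ := (D.c_eq_iff _ _).1 b2.symm
  obtain ⟨x, y, hxy⟩ := D.sumsq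
  have h0 := h _ (show diagQF r (fun l => if l = i then (1 : K) else if l = j then x * s else
      if l = k then y * t else 0) = 0 by
    rw [diagQF_three r hij hjk hik]
    have e1 : (r i : K) = r j * s ^ 2 := by
      have := congrArg (fun x : Kˣ => (x : K)) hs
      simpa using this
    have e2 : (r i : K) = r k * t ^ 2 := by
      have := congrArg (fun x : Kˣ => (x : K)) ht
      simpa using this
    linear_combination (r i : K) * hxy - x ^ 2 * e1 - y ^ 2 * e2)
  have := congrFun h0 i
  simp at this

theorem SqData.block {m : ℕ} (r : Fin m → Kˣ) (h : D.Good r) (v : Fin m → K) (t : ZMod 2) :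
    ∃ (a : Kˣ) (x y : K), (D.c a).2 = t ∧
      ∑ i ∈ Finset.univ.filter (fun i => (D.c (r i)).2 = t), (r i : K) * (v i * v i) =
        a * (x ^ 2 - D.u * y ^ 2) ∧
      (x = 0 → y = 0 → ∀ i, (D.c (r i)).2 = t → v i = 0) := by
  classical
  set I := Finset.univ.filter (fun i => (D.c (r i)).2 = t) with hI
  have hmem : ∀ i, i ∈ I ↔ (D.c (r i)).2 = t := fun i => by simp [hI]
  have hcard : I.card ≤ 2 := by
    by_contra hc
    obtain ⟨i, j, k, hi, hj, hk, hij, hik, hjk⟩ := Finset.two_lt_card_iff.1 (not_le.1 hc)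
    rw [hmem] at hi hj hk
    exact h.2 i j k hij hjk hik (hi.trans hj.symm) (hi.trans hk.symm)
  have h3 : I.card = 0 ∨ I.card = 1 ∨ I.card = 2 := by omega
  rcases h3 with h0 | h1 | h2
  · rw [Finset.card_eq_zero] at h0
    obtain ⟨a, ha⟩ := D.c_surj (0, t)
    refine ⟨a, 0, 0, by rw [ha], by simp [h0], fun _ _ i hi => ?_⟩
    rw [← hmem, h0] at hi
    simp at hi
  · obtain ⟨i, hi⟩ := Finset.card_eq_one.1 h1
    have hit : (D.c (r i)).2 = t := by rw [← hmem, hi]; simp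
    refine ⟨r i, v i, 0, hit, by rw [hi]; simp; ring, fun hx _ j hj => ?_⟩
    rw [← hmem, hi, Finset.mem_singleton] at hj
    rw [hj, hx]
  · obtain ⟨i, j, hij, hi⟩ := Finset.card_eq_two.1 h2
    have hit : (D.c (r i)).2 = t := by rw [← hmem, hi]; simp
    have hjt : (D.c (r j)).2 = t := by rw [← hmem, hi]; simp
    have a1 := h.1 i j hij
    rw [D.c_neg'] at a1
    have a2 := zmod_aux2 _ _ _ D.c_neg a1 (hit.trans hjt.symm)
    rw [← D.c_u, ← D.c_mul, ← D.c_neg'] at a2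
    obtain ⟨s, hs⟩ := (D.c_eq_iff _ _).1 a2.symm
    have e1 : (r j : K) = -(D.u * r i) * s ^ 2 := by
      have := congrArg (fun x : Kˣ => (x : K)) hs
      simpa using this
    refine ⟨r i, v i, s * v j, hit, ?_, fun hx hy k hk => ?_⟩
    · rw [hi, Finset.sum_pair hij, e1]; ring
    · rw [← hmem, hi, Finset.mem_insert, Finset.mem_singleton] at hk
      rcases hk with rfl | rfl
      · exact hx
      · simpa using hy

theorem zmod_aux3 : ∀ t : ZMod 2, t ≠ 0 ↔ t = 1 := by decide

theorem SqData.aniso_of_good {m : ℕ} (r : Fin m → Kˣ) (h : D.Good r) :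
    QuadraticMap.Anisotropic (diagQF r) := by
  intro v hv
  obtain ⟨a, x, y, ha, hs, h0⟩ := D.block r h v 0
  obtain ⟨b, z, w, hb, hs', h1⟩ := D.block r h v 1
  rw [diagQF_apply, ← Finset.sum_filter_add_sum_filter_not _ (fun i => (D.c (r i)).2 = 0)] at hv
  simp only [zmod_aux3] at hv
  rw [hs, hs'] at hv
  obtain ⟨⟨rfl, rfl⟩, rfl, rfl⟩ := D.aniso a b x y z w (by rw [ha, hb]; decide) hv
  ext i
  by_cases hi : (D.c (r i)).2 = 0
  · exact h0 rfl rfl i hi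
  · exact h1 rfl rfl i ((zmod_aux3 _).1 hi)

theorem SqData.aniso_iff {m : ℕ} (r : Fin m → Kˣ) :
    QuadraticMap.Anisotropic (diagQF r) ↔ D.Good r :=
  ⟨D.good_of_aniso r, D.aniso_of_good r⟩

theorem rep_iff_not {m : ℕ} (r : Fin m → Kˣ) (h : QuadraticMap.Anisotropic (diagQF r))
    (a : Kˣ) : (∃ v, diagQF r v = a) ↔
      ¬ QuadraticMap.Anisotropic (diagQF (Fin.cons (-a) r : Fin (m + 1) → Kˣ)) := by
  constructor
  · rintro ⟨v, hv⟩ hA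
    have h0 := hA (Fin.cons 1 v) (by rw [diagQF_cons, hv]; simp)
    have := congrFun h0 0
    simp at this
  · intro hA
    simp only [QuadraticMap.Anisotropic, not_forall] at hA
    obtain ⟨x, hx, hne⟩ := hA
    rw [← Fin.cons_self_tail x, diagQF_cons] at hx
    by_cases h0 : x 0 = 0
    · exfalso
      apply hne
      rw [h0] at hx
      have := h (Fin.tail x) (by simpa using hx)
      rw [← Fin.cons_self_tail x, this, h0]
      ext i
      refine Fin.cases ?_ (fun j => ?_) i <;> simp
    · refine ⟨(x 0)⁻¹ • Fin.tail x, ?_⟩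
      rw [QuadraticMap.map_smul, smul_eq_mul]
      have : diagQF r (Fin.tail x) = a * (x 0 * x 0) := by
        push_cast at hx
        linear_combination hx
      rw [this]
      field_simp

theorem SqData.rep_iff {m : ℕ} (r : Fin m → Kˣ) (h : QuadraticMap.Anisotropic (diagQF r))
    (a : Kˣ) : (∃ v, diagQF r v = a) ↔ (∃ i, D.c (r i) = D.c a) ∨
      (∃ i j, i ≠ j ∧ (D.c (r i)).2 = (D.c a).2 ∧ (D.c (r j)).2 = (D.c a).2) := by
  rw [rep_iff_not r h, D.aniso_iff]
  have hg := D.good_of_aniso r h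
  have hnn : ∀ b b' : Kˣ, D.c b = D.c (-b') → D.c b' = D.c (-b) := by
    intro b b' hb
    rw [D.c_neg'] at hb ⊢
    rw [hb, ← add_assoc, CharTwo.add_self_eq_zero, zero_add]
  constructor
  · intro hn
    by_contra hc
    push Not at hc
    obtain ⟨hc1, hc2⟩ := hc
    apply hn
    refine ⟨?_, ?_⟩
    · intro i j
      refine Fin.cases ?_ (fun i => ?_) i <;> refine Fin.cases ?_ (fun j => ?_) j
      · simp
      · intro _
        simpa using hc1 j
      · intro _
        simp only [Fin.cons_zero, Fin.cons_succ]
        intro hh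
        have := hnn _ _ hh
        rw [neg_neg] at this
        exact hc1 i this
      · intro hij
        simpa using hg.1 i j (by simpa using hij)
    · intro i j k
      refine Fin.cases ?_ (fun i => ?_) i <;> refine Fin.cases ?_ (fun j => ?_) j <;>
        refine Fin.cases ?_ (fun k => ?_) k <;>
        simp only [Fin.cons_zero, Fin.cons_succ, D.c_neg_snd, ne_eq, not_true_eq_false,
          Fin.succ_inj, IsEmpty.forall_iff, implies_true]
      · intro _ hjk _ e1 e2
        exact hc2 j k hjk e1.symm e2.symm
      · intro _ _ hik e1 e2
        exact hc2 i k hik e1 (e2 ▸ e1)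
      · intro hij _ _ e1 e2
        exact hc2 i j hij e2 (e1 ▸ e2)
      · intro hij hjk hik e1 e2
        exact hg.2 i j k hij hjk hik e1 e2
  · rintro (⟨i, hi⟩ | ⟨i, j, hij, e1, e2⟩) hn
    · have := hn.1 0 i.succ (Fin.succ_ne_zero i).symm
      simp only [Fin.cons_zero, Fin.cons_succ, neg_neg] at this
      exact this hi
    · refine hn.2 0 i.succ j.succ (Fin.succ_ne_zero i).symm (by simpa using hij)
        (Fin.succ_ne_zero j).symm ?_ ?_
      · simp [D.c_neg_snd, e1]
      · simp [D.c_neg_snd, e2]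
end classes

section counting
variable {K : Type} [Field K] (D : SqData K)

open Classical in
/-- The square classes represented by a diagonal form with classes `g`. -/
noncomputable def classValues {m : ℕ} (g : Fin m → ZMod 2 × ZMod 2) : Finset (ZMod 2 × ZMod 2) :=
  Finset.univ.filter (fun s => (∃ i, g i = s) ∨ (∃ i j, i ≠ j ∧ (g i).2 = s.2 ∧ (g j).2 = s.2))

theorem card_snd_fiber : ∀ t : ZMod 2,
    (Finset.univ.filter (fun s : ZMod 2 × ZMod 2 => s.2 = t)).card = 2 := by
  decide

theorem card_cons_split {S : Type} [Fintype S] {m : ℕ} (P : (Fin (m + 1) → S) → Prop) :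
    Nat.card {f : Fin (m + 1) → S // P f} =
      ∑ s : S, Nat.card {f : Fin m → S // P (Fin.cons s f : Fin (m + 1) → S)} := by
  have e : {f : Fin (m + 1) → S // P f} ≃
      Σ s : S, {f : Fin m → S // P (Fin.cons s f : Fin (m + 1) → S)} :=
    { toFun := fun f => ⟨f.1 0, ⟨Fin.tail f.1, by rw [Fin.cons_self_tail]; exact f.2⟩⟩
      invFun := fun x => ⟨Fin.cons x.1 x.2.1, x.2.2⟩
      left_inv := fun f => by
        ext1
        exact Fin.cons_self_tail f.1
      right_inv := fun x => rfl }
  rw [Nat.card_congr e, Nat.card_sigma]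

theorem card_classValues {m : ℕ} (g : Fin m → ZMod 2 × ZMod 2)
    (h : ∀ i j k, i ≠ j → j ≠ k → i ≠ k → (g i).2 = (g j).2 → (g i).2 = (g k).2 → False) :
    (classValues g).card = m := by
  classical
  have h1 := Finset.card_eq_sum_card_fiberwise (s := classValues g) (t := Finset.univ)
    (f := fun s => s.2) (fun _ _ => by simp)
  have h2 := Finset.card_eq_sum_card_fiberwise (s := (Finset.univ : Finset (Fin m)))
    (t := Finset.univ) (f := fun i => (g i).2) (fun _ _ => by simp)
  rw [Finset.card_univ, Fintype.card_fin] at h2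
  rw [h1]
  conv_rhs => rw [h2]
  refine Finset.sum_congr rfl fun t _ => ?_
  set I := Finset.univ.filter (fun i => (g i).2 = t) with hI
  have hmem : ∀ i, i ∈ I ↔ (g i).2 = t := fun i => by simp [hI]
  have hV : ∀ s, s ∈ (classValues g).filter (fun s => s.2 = t) ↔
      s.2 = t ∧ ((∃ i ∈ I, g i = s) ∨ ∃ i ∈ I, ∃ j ∈ I, i ≠ j) := by
    intro s
    simp only [classValues, Finset.mem_filter, Finset.mem_univ, true_and, hmem]
    constructor
    · rintro ⟨⟨i, hi⟩ | ⟨i, j, hij, e1, e2⟩, rfl⟩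
      · exact ⟨rfl, Or.inl ⟨i, by rw [hi], hi⟩⟩
      · exact ⟨rfl, Or.inr ⟨i, e1, j, e2, hij⟩⟩
    · rintro ⟨rfl, ⟨i, _, hi⟩ | ⟨i, e1, j, e2, hij⟩⟩
      · exact ⟨Or.inl ⟨i, hi⟩, rfl⟩
      · exact ⟨Or.inr ⟨i, j, hij, e1, e2⟩, rfl⟩
  have hcard : I.card ≤ 2 := by
    by_contra hc
    obtain ⟨i, j, k, hi, hj, hk, hij, hik, hjk⟩ := Finset.two_lt_card_iff.1 (not_le.1 hc)
    rw [hmem] at hi hj hk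
    exact h i j k hij hjk hik (hi.trans hj.symm) (hi.trans hk.symm)
  have h3 : I.card = 0 ∨ I.card = 1 ∨ I.card = 2 := by omega
  rcases h3 with h0 | h1 | h2
  · rw [h0, Finset.card_eq_zero, Finset.eq_empty_iff_forall_notMem]
    rw [Finset.card_eq_zero] at h0
    intro s
    rw [hV, h0]
    simp
  · rw [h1]
    obtain ⟨i, hi⟩ := Finset.card_eq_one.1 h1
    have hit : (g i).2 = t := by rw [← hmem, hi]; simp
    rw [Finset.card_eq_one]
    refine ⟨g i, ?_⟩
    ext s
    rw [hV, hi, Finset.mem_singleton]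
    constructor
    · rintro ⟨_, ⟨j, hj, e⟩ | ⟨j, hj, k, hk, hjk⟩⟩
      · rw [Finset.mem_singleton] at hj
        rw [← e, hj]
      · rw [Finset.mem_singleton] at hj hk
        exact absurd (hj.trans hk.symm) hjk
    · rintro rfl
      exact ⟨hit, Or.inl ⟨i, by simp, rfl⟩⟩
  · rw [h2]
    obtain ⟨i, j, hij, hi⟩ := Finset.card_eq_two.1 h2
    have : (classValues g).filter (fun s => s.2 = t) =
        Finset.univ.filter (fun s : ZMod 2 × ZMod 2 => s.2 = t) := by
      ext s
      rw [hV, Finset.mem_filter]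
      simp only [Finset.mem_univ, true_and, and_iff_left_iff_imp]
      intro _
      exact Or.inr ⟨i, by simp [hi], j, by simp [hi], hij⟩
    rw [this]
    exact card_snd_fiber t

/-- A representative of a square class. -/
noncomputable def SqData.rep : ZMod 2 × ZMod 2 → Kˣ := Function.surjInv D.c_surj

theorem SqData.c_rep (s : ZMod 2 × ZMod 2) : D.c (D.rep s) = s :=
  Function.surjInv_eq D.c_surj s

theorem SqData.dcount_eq (m : ℕ) {M : Type} [AddCommGroup M] [Module K M]
    (Q : QuadraticForm K M) :
    DCount K m Q = Nat.card {f : Fin m → ZMod 2 × ZMod 2 // QIsom (diagQF (D.rep ∘ f)) Q} := by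
  unfold DCount
  refine Nat.card_eq_of_bijective (Quot.lift
    (fun r => ⟨fun i => D.c (r.1 i), QIsom.trans' (D.diag_congr _ _ fun i => by
      simp [D.c_rep]) r.2⟩) ?_) ⟨?_, ?_⟩
  · intro r r' h
    ext1
    funext i
    exact (D.c_eq_iff _ _).2 (h i)
  · rintro ⟨r⟩ ⟨r'⟩ h
    apply Quot.sound
    intro i
    have h1 := congrFun (congrArg Subtype.val h) i
    exact (D.c_eq_iff _ _).1 h1
  · rintro ⟨f, hf⟩
    refine ⟨Quot.mk _ ⟨D.rep ∘ f, hf⟩, ?_⟩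
    ext1
    funext i
    exact D.c_rep _

theorem SqData.count_aniso (m : ℕ) : ∀ (Q : QF K m), QuadraticMap.Anisotropic Q →
    Nat.card {f : Fin m → ZMod 2 × ZMod 2 // QIsom (diagQF (D.rep ∘ f)) Q} = m.factorial := by
  induction m with
  | zero =>
    intro Q hQ
    obtain ⟨r, hr⟩ := exists_diag D.two (m := 0) (by simp) Q hQ
    rw [Nat.factorial_zero, Nat.card_eq_one_iff_unique]
    refine ⟨⟨fun a b => Subtype.ext (Subsingleton.elim _ _)⟩, ⟨⟨Fin.elim0, ?_⟩⟩⟩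
    convert hr
  | succ m ih =>
    intro Q hQ
    obtain ⟨r, hr⟩ := exists_diag D.two (m := m + 1) (by simp) Q hQ
    have hra := hr.aniso hQ
    have hgood := D.good_of_aniso r hra
    set V := classValues (fun i => D.c (r i)) with hV
    have hVc : V.card = m + 1 := card_classValues _ hgood.2
    have hVm : ∀ s, s ∈ V ↔ ∃ v, Q v = D.rep s := by
      intro s
      have h1 := D.rep_iff r hra (D.rep s)
      rw [D.c_rep] at h1
      have h2 : (∃ v, Q v = D.rep s) ↔ ∃ v, diagQF r v = D.rep s := by
        obtain ⟨φ, hφ⟩ := hr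
        constructor
        · rintro ⟨v, hv⟩
          exact ⟨φ.symm v, by rw [← hφ]; simpa using hv⟩
        · rintro ⟨v, hv⟩
          exact ⟨φ v, by rw [hφ, hv]⟩
      rw [h2, h1]
      simp [hV, classValues]
    have key : ∀ s, Nat.card {f : Fin m → ZMod 2 × ZMod 2 //
        QIsom (diagQF (D.rep ∘ (Fin.cons s f : Fin (m + 1) → ZMod 2 × ZMod 2))) Q} =
        if s ∈ V then m.factorial else 0 := by
      intro s
      have hcomp : ∀ f : Fin m → ZMod 2 × ZMod 2,
          D.rep ∘ (Fin.cons s f : Fin (m + 1) → ZMod 2 × ZMod 2) =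
            (Fin.cons (D.rep s) (D.rep ∘ f) : Fin (m + 1) → Kˣ) := fun f => by
        funext i
        refine Fin.cases ?_ (fun j => ?_) i <;> simp
      split_ifs with hs
      · obtain ⟨v, hv⟩ := (hVm s).1 hs
        obtain ⟨g, hg⟩ := exists_cons D.two Q hQ (D.rep s) v hv
        have hga := hg.aniso hQ
        have hga' : QuadraticMap.Anisotropic (diagQF g) := by
          intro x hx
          have h1 := hga (Fin.cons 0 x) (by rw [diagQF_cons, hx]; simp)
          ext i
          simpa using congrFun h1 i.succ
        rw [← ih (diagQF g) hga']
        refine Nat.card_congr (Equiv.subtypeEquivRight fun f => ?_)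
        rw [hcomp]
        constructor
        · intro h
          exact witt_cancel D.two _ _ _ hga (h.trans' hg.symm')
        · intro h
          refine QIsom.trans' ?_ hg
          obtain ⟨ψ, hψ⟩ := h
          refine ⟨(Fin.consLinearEquiv K (fun _ => K)).symm.trans
            (((LinearEquiv.refl K K).prodCongr ψ).trans (Fin.consLinearEquiv K (fun _ => K))), ?_⟩
          intro x
          obtain ⟨y, x, rfl⟩ : ∃ (y0 : K) (y' : Fin m → K),
              x = (Fin.cons y0 y' : Fin (m + 1) → K) :=
            ⟨x 0, Fin.tail x, (Fin.cons_self_tail x).symm⟩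
          have : ((Fin.consLinearEquiv K (fun _ => K)).symm.trans
            (((LinearEquiv.refl K K).prodCongr ψ).trans (Fin.consLinearEquiv K (fun _ => K))))
              (Fin.cons y x : Fin (m + 1) → K) = (Fin.cons y (ψ x) : Fin (m + 1) → K) := by
            rfl
          rw [this, diagQF_cons, diagQF_cons, hψ]
      · rw [Nat.card_eq_zero]
        left
        refine ⟨fun ⟨f, φ, hφ⟩ => hs ((hVm s).2 ⟨φ (Fin.cons 1 0), ?_⟩)⟩
        rw [hφ, hcomp, diagQF_cons]
        simp
    rw [card_cons_split, Finset.sum_congr rfl (fun s _ => key s),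
      Finset.sum_ite_mem, Finset.univ_inter, Finset.sum_const, hVc, smul_eq_mul,
      Nat.factorial_succ]

theorem SqData.neg_symm (b b' : Kˣ) (hb : D.c b = D.c (-b')) : D.c b' = D.c (-b) := by
  rw [D.c_neg'] at hb ⊢
  rw [hb, ← add_assoc, CharTwo.add_self_eq_zero, zero_add]

theorem SqData.hyp_iff (r : Fin 2 → Kˣ) :
    QIsom (diagQF r) (HypForm K) ↔ D.c (r 1) = D.c (-(r 0)) := by
  have hH : ∀ z : K × K, HypForm K z = z.1 * z.2 := fun z => by simp [HypForm]
  constructor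
  · intro h
    by_contra hc
    have hg : D.Good r := by
      refine ⟨?_, ?_⟩
      · intro i j hij
        fin_cases i <;> fin_cases j
        · exact absurd rfl hij
        · exact hc
        · exact fun h => hc (D.neg_symm _ _ h)
        · exact absurd rfl hij
      · intro i j k hij hjk hik
        omega
    have h1 := h.symm'.aniso (D.aniso_of_good r hg) (1, 0) (by simp [hH])
    simp at h1
  · intro h
    obtain ⟨s, hs⟩ := (D.c_eq_iff _ _).1 h.symm
    have e1 : (r 1 : K) = -(r 0) * s ^ 2 := by
      have := congrArg (fun x : Kˣ => (x : K)) hs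
      simpa using this
    let p0 : (Fin 2 → K) →ₗ[K] K := LinearMap.proj 0
    let p1 : (Fin 2 → K) →ₗ[K] K := LinearMap.proj 1
    let φ : (Fin 2 → K) →ₗ[K] K × K :=
      ((r 0 : K) • (p0 - (s : K) • p1)).prod (p0 + (s : K) • p1)
    have hφ : ∀ x, φ x = ((r 0 : K) * (x 0 - s * x 1), x 0 + s * x 1) := fun x => rfl
    refine qisom_of_map (by simp) φ ?_ ?_
    · intro x
      rw [hφ, hH, diagQF_apply, Fin.sum_univ_two, e1]
      ring
    · rw [injective_iff_map_eq_zero]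
      intro x hx
      rw [hφ, Prod.mk_eq_zero] at hx
      obtain ⟨h1, h2⟩ := hx
      have h1' : x 0 - s * x 1 = 0 := by simpa using h1
      have h3 : (2 : K) * x 0 = 0 := by linear_combination h1' + h2
      have h4 : x 0 = 0 := by simpa [D.two] using h3
      rw [h4, zero_add] at h2
      have h5 : x 1 = 0 := by simpa using h2
      ext i
      fin_cases i
      · exact h4
      · exact h5

theorem SqData.count_hyp (D : SqData K) : DCount K 2 (HypForm K) = 4 := by
  rw [D.dcount_eq]
  have e : {f : Fin 2 → ZMod 2 × ZMod 2 // QIsom (diagQF (D.rep ∘ f)) (HypForm K)} ≃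
      ZMod 2 × ZMod 2 :=
    { toFun := fun f => f.1 0
      invFun := fun s => ⟨![s, D.c (-1) + s], by
        rw [D.hyp_iff]
        have h := D.c_neg' (D.rep s)
        rw [D.c_rep] at h
        simpa [D.c_rep] using h.symm⟩
      left_inv := fun f => by
        have h := (D.hyp_iff _).1 f.2
        rw [D.c_neg'] at h
        simp only [Function.comp_apply, D.c_rep] at h
        ext1
        funext i
        fin_cases i
        · rfl
        · exact h.symm
      right_inv := fun s => rfl }
  rw [Nat.card_congr e]
  simp
end counting
open ValuativeRel in
theorem dvr_of_finite (p : ℕ) [Fact p.Prime] (K : Type) [Field K]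
    [Algebra ℚ_[p] K] [FiniteDimensional ℚ_[p] K] :
    ∃ (R : Type) (_ : CommRing R) (_ : IsDomain R) (_ : IsDiscreteValuationRing R)
      (_ : Algebra R K), IsFractionRing R K ∧ HenselianRing R (IsLocalRing.maximalIdeal R) ∧
      Finite (IsLocalRing.ResidueField R) ∧ CharP (IsLocalRing.ResidueField R) p := by
  let := spectralNorm.nontriviallyNormedField ℚ_[p] K
  let : NormedSpace ℚ_[p] K := spectralNorm.normedSpace ℚ_[p] K
  have : IsUltrametricDist K :=
    IsUltrametricDist.isUltrametricDist_of_isNonarchimedean_norm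
      (isNonarchimedean_spectralNorm (K := ℚ_[p]) (L := K))
  have : ProperSpace K := FiniteDimensional.proper ℚ_[p] K
  let : ValuativeRel K := ValuativeRel.ofValuation (NormedField.valuation (K := K))
  have hc : (NormedField.valuation (K := K)).Compatible :=
    Valuation.Compatible.ofValuation _
  have hlc : LocallyCompactSpace K := inferInstance
  have hnt : ValuativeRel.IsNontrivial K := by
    rw [isNontrivial_iff_isNontrivial (NormedField.valuation (K := K)),
      Valuation.isNontrivial_iff_exists_lt_one]
    obtain ⟨x, hx, hx'⟩ := NormedField.exists_norm_lt_one K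
    refine ⟨x, by simpa using hx, by simpa [← NNReal.coe_lt_coe] using hx'⟩
  have hvt : IsValuativeTopology K := by
    refine IsValuativeTopology.of_mem_nhds_zero_iff_vle (NormedField.valuation (K := K)) ?_
    intro s
    exact (NormedField.toValued (K := K)).is_topological_valuation s
  have hloc : IsNonarchimedeanLocalField K := { }
  refine ⟨𝒪[K], inferInstance, inferInstance, inferInstance, inferInstance, inferInstance,
    inferInstance, inferInstance, ?_⟩
  have hp : (p : 𝒪[K]) ∈ IsLocalRing.maximalIdeal 𝒪[K] := by
    rw [IsLocalRing.mem_maximalIdeal, mem_nonunits_iff]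
    intro hu
    obtain ⟨w, hw⟩ := hu.exists_right_inv
    have hw1 : ((p : K)) * (w : K) = 1 := by
      have := congrArg (Subtype.val) hw
      simpa using this
    have hw2 : ‖(w : K)‖ ≤ 1 := by
      have := w.2
      rw [Valuation.mem_integer_iff, ← map_one (valuation K),
        ← Valuation.Compatible.vle_iff_le (v := valuation K),
        Valuation.Compatible.vle_iff_le (v := NormedField.valuation (K := K)), map_one] at this
      exact_mod_cast this
    have hpn : ‖(p : K)‖ < 1 := by
      have h1 : (p : K) = algebraMap ℚ_[p] K p := by simp
      have h2 : ‖algebraMap ℚ_[p] K p‖ = ‖(p : ℚ_[p])‖ := spectralNorm_extends _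
      rw [h1, h2]
      exact Padic.norm_p_lt_one
    have := congrArg norm hw1
    rw [norm_mul, norm_one] at this
    nlinarith [norm_nonneg (w : K), norm_nonneg (p : K)]
  have h0 : (p : IsLocalRing.ResidueField 𝒪[K]) = 0 := by
    rw [← map_natCast (IsLocalRing.residue 𝒪[K])]
    exact (IsLocalRing.residue_eq_zero_iff _).2 hp
  obtain ⟨q, hq⟩ := CharP.exists (IsLocalRing.ResidueField 𝒪[K])
  have hqp : q ∣ p := (CharP.cast_eq_zero_iff _ q p).1 h0
  rcases (Nat.dvd_prime Fact.out).1 hqp with h | h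
  · exact absurd h (CharP.char_ne_one (IsLocalRing.ResidueField 𝒪[K]) q)
  · exact h ▸ hq

section dvr
variable {R K : Type} [CommRing R] [IsDomain R] [IsDiscreteValuationRing R] [Field K]
  [Algebra R K] [IsFractionRing R K]

theorem unit_pow_eq_one {q : R} (hq : Irreducible q) (w : Rˣ) (n : ℤ)
    (h : algebraMap R K w * (algebraMap R K q) ^ n = 1) : n = 0 := by
  have hq0 : algebraMap R K q ≠ 0 := by simpa using hq.ne_zero
  have key : ∀ (k : ℕ) (w : Rˣ), algebraMap R K w * (algebraMap R K q) ^ k = 1 → k = 0 := by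
    intro k w h
    rw [← map_pow, ← map_mul, ← map_one (algebraMap R K)] at h
    have h := IsFractionRing.injective R K h
    have hu : IsUnit (q ^ k) := IsUnit.of_mul_eq_one (w : R) (by rw [mul_comm]; exact h)
    by_contra hk
    exact hq.not_isUnit ((isUnit_pow_iff hk).1 hu)
  rcases Int.eq_nat_or_neg n with ⟨k, rfl | rfl⟩
  · have := key k w (by simpa using h)
    simp [this]
  · have h2 : algebraMap R K (w⁻¹ : Rˣ) * (algebraMap R K q) ^ k = 1 := by
      have hw : algebraMap R K (w : R) * algebraMap R K ((w⁻¹ : Rˣ) : R) = 1 := by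
        rw [← map_mul]; simp
      have hk : (algebraMap R K q) ^ k ≠ 0 := pow_ne_zero _ hq0
      rw [zpow_neg, zpow_natCast] at h
      have h3 : algebraMap R K (w : R) = (algebraMap R K q) ^ k := by
        field_simp at h; exact h
      rw [← h3, mul_comm]; exact hw
    have := key k _ h2
    simp [this]

theorem exists_unit_pow {q : R} (hq : Irreducible q) (a : Kˣ) :
    ∃ (n : ℤ) (w : Rˣ), (a : K) = algebraMap R K w * (algebraMap R K q) ^ n := by
  have hq0 : algebraMap R K q ≠ 0 := by simpa using hq.ne_zero
  obtain ⟨x, y, hy, hxy⟩ := IsFractionRing.div_surjective (A := R) (a : K)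
  have hy0 : y ≠ 0 := nonZeroDivisors.ne_zero hy
  have hx0 : x ≠ 0 := by
    rintro rfl
    apply a.ne_zero
    rw [← hxy]; simp
  obtain ⟨m, v, hv⟩ := IsDiscreteValuationRing.eq_unit_mul_pow_irreducible hx0 hq
  obtain ⟨k, w, hw⟩ := IsDiscreteValuationRing.eq_unit_mul_pow_irreducible hy0 hq
  refine ⟨(m : ℤ) - k, v * w⁻¹, ?_⟩
  have hww : algebraMap R K ((w⁻¹ : Rˣ) : R) * algebraMap R K (w : R) = 1 := by
    rw [← map_mul]; simp
  have hw0 : algebraMap R K (w : R) ≠ 0 := right_ne_zero_of_mul_eq_one hww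
  rw [← hxy, hv, hw, zpow_sub₀ hq0]
  simp only [map_mul, map_pow, Units.val_mul, zpow_natCast]
  rw [eq_inv_of_mul_eq_one_left hww]
  field_simp

variable [HenselianRing R (IsLocalRing.maximalIdeal R)]

open IsLocalRing in
theorem isSquare_of_residue (h2 : (2 : ResidueField R) ≠ 0) (w : R) (hw : residue R w ≠ 0)
    (hs : IsSquare (residue R w)) : ∃ s : R, w = s ^ 2 := by
  obtain ⟨b, hb⟩ := hs
  obtain ⟨t, rfl⟩ := residue_surjective b
  have ht : residue R t ≠ 0 := by
    intro h; rw [h] at hb; exact hw (by simpa using hb)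
  obtain ⟨s, hs, -⟩ := HenselianRing.is_henselian (I := maximalIdeal R)
    (Polynomial.X ^ 2 - Polynomial.C w) (Polynomial.monic_X_pow_sub_C w two_ne_zero) t
    (by
      rw [← residue_eq_zero_iff]
      simp [hb, pow_two])
    (by
      have : IsUnit (2 * t) := by
        rw [← residue_ne_zero_iff_isUnit]
        simp only [map_mul, map_ofNat]
        exact mul_ne_zero h2 ht
      have := this.map (Ideal.Quotient.mk (maximalIdeal R))
      simpa [one_add_one_eq_two] using this)
  refine ⟨s, ?_⟩
  have : s ^ 2 - w = 0 := by simpa [Polynomial.IsRoot] using hs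
  exact (sub_eq_zero.1 this).symm

open IsLocalRing in
open Classical in
theorem exists_sqData (p : ℕ) [Fact p.Prime] (hp : p ≠ 2) [Finite (ResidueField R)]
    [CharP (ResidueField R) p] : Nonempty (SqData K) := by
  obtain ⟨q, hq⟩ := IsDiscreteValuationRing.exists_irreducible R
  have : Fintype (ResidueField R) := Fintype.ofFinite _
  have hch : ringChar (ResidueField R) ≠ 2 := by
    rw [ringChar.eq (ResidueField R) p]; exact hp
  have h2 : (2 : ResidueField R) ≠ 0 := Ring.two_ne_zero hch
  have hq0 : algebraMap R K q ≠ 0 := by simpa using hq.ne_zero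
  have inj : Function.Injective (algebraMap R K) := IsFractionRing.injective R K
  choose n w hnw using exists_unit_pow (K := K) hq
  have hwne : ∀ v : Rˣ, residue R v ≠ 0 := fun v => (residue_ne_zero_iff_isUnit _).2 v.isUnit
  have uniq : ∀ (a : Kˣ) (m : ℤ) (v : Rˣ), (a : K) = algebraMap R K v * (algebraMap R K q) ^ m →
      n a = m ∧ w a = v := by
    intro a m v h
    have hvv : algebraMap R K ((v⁻¹ : Rˣ) : R) * algebraMap R K (v : R) = 1 := by
      rw [← map_mul]; simp
    have hv0 : algebraMap R K (v : R) ≠ 0 := right_ne_zero_of_mul_eq_one hvv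
    have h1 : n a - m = 0 := by
      refine unit_pow_eq_one (K := K) hq (w a * v⁻¹) _ ?_
      have h3 := (hnw a).symm.trans h
      rw [zpow_sub₀ hq0, Units.val_mul, map_mul, eq_inv_of_mul_eq_one_left hvv]
      have : (algebraMap R K q) ^ m ≠ 0 := zpow_ne_zero _ hq0
      field_simp
      rw [h3]
    have h1 : n a = m := by omega
    refine ⟨h1, ?_⟩
    have h3 := (hnw a).symm.trans h
    rw [h1] at h3
    exact Units.ext (inj (mul_right_cancel₀ (zpow_ne_zero _ hq0) h3))
  have hmul : ∀ a b, n (a * b) = n a + n b ∧ w (a * b) = w a * w b := by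
    intro a b
    apply uniq
    rw [Units.val_mul, Units.val_mul, map_mul, zpow_add₀ hq0]
    have ha := hnw a
    have hb := hnw b
    generalize (a : K) = A at ha
    generalize (b : K) = B at hb
    rw [ha, hb]
    ring
  let χ : ResidueField R → ZMod 2 := fun x => if IsSquare x then 0 else 1
  have hχ : ∀ x y, x ≠ 0 → y ≠ 0 → χ (x * y) = χ x + χ y := by
    intro x y hx hy
    have e : ∀ z : ResidueField R, z ≠ 0 → (IsSquare z ↔ quadraticChar (ResidueField R) z = 1) :=
      fun z hz => (quadraticChar_one_iff_isSquare hz).symm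
    have e' : ∀ z : ResidueField R, z ≠ 0 → quadraticChar (ResidueField R) z = 1 ∨
      quadraticChar (ResidueField R) z = -1 := fun z hz => quadraticChar_dichotomy hz
    simp only [χ, e _ hx, e _ hy, e _ (mul_ne_zero hx hy), map_mul]
    rcases e' x hx with h | h <;> rcases e' y hy with h' | h' <;> simp [h, h'] <;> decide
  obtain ⟨ub, hub⟩ := FiniteField.exists_nonsquare hch
  have hub0 : ub ≠ 0 := by rintro rfl; exact hub (IsSquare.zero)
  obtain ⟨u0, rfl⟩ := residue_surjective ub
  obtain ⟨u, rfl⟩ := (residue_ne_zero_iff_isUnit _).1 hub0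
  let uK : Kˣ := Units.map (algebraMap R K).toMonoidHom u
  have huK : (uK : K) = algebraMap R K u := rfl
  let qK : Kˣ := Units.mk0 _ hq0
  have hunit : ∀ v : Rˣ, n (Units.map (algebraMap R K).toMonoidHom v) = 0 ∧
      w (Units.map (algebraMap R K).toMonoidHom v) = v := fun v => uniq _ _ _ (by simp)
  have huc : n uK = 0 ∧ w uK = u := hunit u
  have h11 : n 1 = 0 ∧ w 1 = 1 := uniq 1 0 1 (by simp)
  have hqK : n qK = 1 ∧ w qK = 1 := uniq _ _ _ (by simp [qK])
  have hneg : n (-1) = 0 := (uniq (-1) 0 (-1) (by simp)).1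
  have hN : ∀ x y : K, ¬ (x = 0 ∧ y = 0) → ∃ b : Kˣ, (b : K) = x ^ 2 - uK * y ^ 2 ∧
      ((n b : ℤ) : ZMod 2) = 0 := by
    intro x y hxy
    -- a scaling lemma
    have scal : ∀ (x : K) (r : R), x ≠ 0 → residue R r ≠ 0 → ∃ b : Kˣ,
        (b : K) = x ^ 2 * algebraMap R K r ∧ ((n b : ℤ) : ZMod 2) = 0 := by
      intro x r hx hr
      obtain ⟨r, rfl⟩ := (residue_ne_zero_iff_isUnit _).1 hr
      refine ⟨Units.mk0 x hx * Units.mk0 x hx * Units.map (algebraMap R K).toMonoidHom r,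
        by simp [pow_two], ?_⟩
      rw [(hmul _ _).1, (hmul _ _).1, (hunit r).1]
      push_cast
      rw [CharTwo.add_self_eq_zero, zero_add]
    by_cases hy : y = 0
    · subst hy
      have hx : x ≠ 0 := fun h => hxy ⟨h, rfl⟩
      obtain ⟨b, hb, hb'⟩ := scal x 1 hx (by simp)
      exact ⟨b, by simp [hb], hb'⟩
    by_cases hx : x = 0
    · subst hx
      obtain ⟨b, hb, hb'⟩ := scal y (-u) hy (by simpa using hwne u)
      exact ⟨b, by simp [hb, huK]; ring, hb'⟩
    rcases ValuationRing.isInteger_or_isInteger R (x / y) with ⟨t, ht⟩ | ⟨t, ht⟩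
    · obtain ⟨b, hb, hb'⟩ := scal y (t ^ 2 - u) hy (by
        intro h
        apply hub
        rw [map_sub, sub_eq_zero, map_pow, pow_two] at h
        exact ⟨_, h.symm⟩)
      refine ⟨b, ?_, hb'⟩
      rw [hb, map_sub, map_pow, ht, huK]
      field_simp
    · obtain ⟨b, hb, hb'⟩ := scal x (1 - u * t ^ 2) hx (by
        intro h
        apply hub
        rw [map_sub, sub_eq_zero, map_mul, map_pow, map_one] at h
        have ht0 : residue R t ≠ 0 := by
          intro h0; rw [h0] at h; simp at h
        refine ⟨(residue R t)⁻¹, ?_⟩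
        field_simp
        exact h.symm)
      refine ⟨b, ?_, hb'⟩
      rw [hb, map_sub, map_mul, map_pow, ht, huK, map_one]
      field_simp
  refine ⟨⟨fun a => (χ (residue R (w a)), ((n a : ℤ) : ZMod 2)), ?_, ?_, ?_, uK, ?_, ?_, ?_, ?_, ?_⟩⟩
  · intro a b
    simp [hmul, hχ _ _ (hwne (w a)) (hwne (w b))]
  · intro a
    constructor
    · intro h
      rw [Prod.mk_eq_zero] at h
      obtain ⟨h1, h3⟩ := h
      have hsq : IsSquare (residue R (w a : R)) := by
        by_contra hns
        simp [χ, hns] at h1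
      obtain ⟨s, hs⟩ := isSquare_of_residue h2 _ (hwne _) hsq
      rw [ZMod.intCast_zmod_eq_zero_iff_dvd] at h3
      obtain ⟨k, hk⟩ := h3
      have hs0 : algebraMap R K s * (algebraMap R K q) ^ k ≠ 0 := by
        refine mul_ne_zero ?_ (zpow_ne_zero _ hq0)
        intro h0
        have := inj (h0.trans (map_zero _).symm)
        subst this
        exact (w a).ne_zero (by simpa using hs)
      refine ⟨Units.mk0 _ hs0, Units.ext ?_⟩
      rw [hnw a, hk, hs]
      simp only [Units.val_pow_eq_pow_val, Units.val_mk0, map_pow, mul_pow]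
      congr 1
      rw [← zpow_natCast, ← zpow_mul, mul_comm]
    · rintro ⟨s, rfl⟩
      rw [pow_two, (hmul _ _).1, (hmul _ _).2, Units.val_mul, map_mul, hχ _ _ (hwne _) (hwne _)]
      push_cast
      simp [CharTwo.add_self_eq_zero]
  · rintro ⟨i, j⟩
    have hcu : χ (residue R (u : R)) = 1 := by simp [χ, hub]
    have hc1 : χ (1 : ResidueField R) = 0 := by simp [χ]
    have h01 : ∀ i : ZMod 2, i = 0 ∨ i = 1 := by decide
    rcases h01 i with rfl | rfl <;> rcases h01 j with rfl | rfl
    · exact ⟨1, Prod.ext (by simp [h11, hc1]) (by simp [h11])⟩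
    · exact ⟨qK, Prod.ext (by simp [hqK, hc1]) (by simp [hqK])⟩
    · exact ⟨uK, Prod.ext (by simp [huc, hcu]) (by simp [huc])⟩
    · exact ⟨uK * qK, Prod.ext (by simp [hmul, huc, hqK, hcu]) (by simp [hmul, huc, hqK])⟩
  · exact Prod.ext (by simp [huc, χ, hub]) (by simp [huc])
  · simp [hneg]
  · intro a b x y z t hab h
    by_contra hcon
    simp only at hab
    by_cases hxy : x = 0 ∧ y = 0
    · obtain ⟨rfl, rfl⟩ := hxy
      obtain ⟨d, hd, hd'⟩ := hN z t (fun hz => hcon ⟨⟨rfl, rfl⟩, hz⟩)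
      rw [← hd] at h
      simp at h
    · obtain ⟨e, he, he'⟩ := hN x y hxy
      rw [← he] at h
      by_cases hzt : z = 0 ∧ t = 0
      · obtain ⟨rfl, rfl⟩ := hzt
        simp at h
      · obtain ⟨d, hd, hd'⟩ := hN z t hzt
        rw [← hd] at h
        have hh : a * e = (-1) * (b * d) := by
          ext
          push_cast
          linear_combination h
        have := congrArg n hh
        rw [(hmul _ _).1, (hmul _ _).1, (hmul _ _).1, hneg] at this
        have := congrArg (fun v : ℤ => (v : ZMod 2)) this
        push_cast at this
        rw [he', hd'] at this
        apply hab
        simpa using this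
  · obtain ⟨a, b, hab⟩ := CharP.sq_add_sq (ResidueField R) p (-1)
    have key : ∀ a b : ResidueField R, a ≠ 0 → a ^ 2 + b ^ 2 = -1 →
        ∃ s t : K, s ^ 2 + t ^ 2 = -1 := by
      intro a b ha h
      obtain ⟨t, rfl⟩ := residue_surjective b
      have h1 : residue R (-1 - t ^ 2) = a * a := by
        simp only [map_sub, map_neg, map_one, map_pow]; rw [← h]; ring
      obtain ⟨s, hs⟩ := isSquare_of_residue h2 (-1 - t ^ 2)
        (by rw [h1]; exact mul_ne_zero ha ha) ⟨a, h1⟩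
      refine ⟨algebraMap R K s, algebraMap R K t, ?_⟩
      rw [← map_pow, ← hs]
      simp
    push_cast at hab
    by_cases ha : (a : ResidueField R) = 0
    · refine key b a ?_ (by rw [add_comm]; exact_mod_cast hab)
      intro hb
      rw [ha, hb] at hab
      simp at hab
    · exact key a b ha (by exact_mod_cast hab)
  · intro h
    apply h2
    have h3 : (algebraMap R K) 2 = algebraMap R K 0 := by rw [map_ofNat, map_zero]; exact h
    have h4 := congrArg (residue R) (inj h3)
    rw [map_ofNat, map_zero] at h4
    exact h4
end dvr
/-- The number of diagonal representations of the hyperbolic plane and of each anisotropic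
form, up to squares; in particular for anisotropic forms it depends only on the degree. -/
theorem statement_10 (p : ℕ) [Fact p.Prime] (hp : p ≠ 2) (K : Type) [Field K]
    [Algebra ℚ_[p] K] [FiniteDimensional ℚ_[p] K] :
    DCount K 2 (HypForm K) = 4 ∧
    (∀ Q : QF K 1, QuadraticMap.Anisotropic Q → DCount K 1 Q = 1) ∧
    (∀ Q : QF K 2, QuadraticMap.Anisotropic Q → DCount K 2 Q = 2) ∧
    (∀ Q : QF K 3, QuadraticMap.Anisotropic Q → DCount K 3 Q = 6) ∧
    (∀ Q : QF K 4, QuadraticMap.Anisotropic Q → DCount K 4 Q = 24) ∧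
    (∀ (m : ℕ) (Q Q' : QF K m), QuadraticMap.Anisotropic Q → QuadraticMap.Anisotropic Q' →
      DCount K m Q = DCount K m Q') := by
  obtain ⟨R, _, _, _, _, hfrac, hhens, hfin, hchar⟩ := dvr_of_finite p K
  obtain ⟨D⟩ : Nonempty (SqData K) := exists_sqData (R := R) p hp
  have key : ∀ (m : ℕ) (Q : QF K m), QuadraticMap.Anisotropic Q →
      DCount K m Q = m.factorial := fun m Q hQ => by
    rw [D.dcount_eq, D.count_aniso m Q hQ]
  exact ⟨D.count_hyp, fun Q hQ => key 1 Q hQ, fun Q hQ => key 2 Q hQ, fun Q hQ => key 3 Q hQ,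
    fun Q hQ => key 4 Q hQ, fun m Q Q' hQ hQ' => by rw [key m Q hQ, key m Q' hQ']⟩
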